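/- arXiv:2403.09657 — 2 statements merged into one kernel-verified Lean document; each statement's English description precedes it below -/
import Mathlib

section
/- Fix τ ∈ ℂ with Im τ > 0 and set q = exp(iπτ). For every z ∈ ℂ, θ₁(2z|τ) = (2 / (θ₂(0|τ)·θ₃(0|τ)·θ₄(0|τ))) · θ₁(z|τ)·θ₂(z|τ)·θ₃(z|τ)·θ₄(z|τ). -/
/-- Jacobi theta function θ₁(z|τ), nome q = exp(iπτ). -/
noncomputable def theta1 (z τ : ℂ) : ℂ :=
  2 * ∑' n : ℕ, (-1) ^ n * Complex.exp (Real.pi * Complex.I * τ * ((n : ℂ) + 1 / 2) ^ 2) *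
      Complex.sin ((2 * (n : ℂ) + 1) * z)

/-- Jacobi theta function θ₂(z|τ). -/
noncomputable def theta2 (z τ : ℂ) : ℂ :=
  2 * ∑' n : ℕ, Complex.exp (Real.pi * Complex.I * τ * ((n : ℂ) + 1 / 2) ^ 2) *
      Complex.cos ((2 * (n : ℂ) + 1) * z)

/-- Jacobi theta function θ₃(z|τ). -/
noncomputable def theta3 (z τ : ℂ) : ℂ :=
  1 + 2 * ∑' n : ℕ, Complex.exp (Real.pi * Complex.I * τ * ((n : ℂ) + 1) ^ 2) *
      Complex.cos (2 * ((n : ℂ) + 1) * z)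

/-- Jacobi theta function θ₄(z|τ). -/
noncomputable def theta4 (z τ : ℂ) : ℂ :=
  1 + 2 * ∑' n : ℕ, (-1) ^ (n + 1) * Complex.exp (Real.pi * Complex.I * τ * ((n : ℂ) + 1) ^ 2) *
      Complex.cos (2 * ((n : ℂ) + 1) * z)

open Complex in
/-- The product of two theta functions as a sum of products of theta functions at `2 * τ`,
obtained by splitting the lattice `ℤ × ℤ` according to the parity of the sum of the coordinates. -/
theorem jacobiTheta₂_mul_jacobiTheta₂ (x y : ℂ) {τ : ℂ} (hτ : 0 < τ.im) :
    jacobiTheta₂ x τ * jacobiTheta₂ y τ =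
      jacobiTheta₂ (x + y) (2 * τ) * jacobiTheta₂ (x - y) (2 * τ) +
        cexp (2 * Real.pi * I * x + Real.pi * I * τ) *
          (jacobiTheta₂ (x + y + τ) (2 * τ) * jacobiTheta₂ (x - y + τ) (2 * τ)) := by
  have hτ₂ : 0 < (2 * τ).im := by simpa using hτ
  have hs (w : ℂ) {σ : ℂ} (hσ : 0 < σ.im) : Summable fun n : ℤ ↦ ‖jacobiTheta₂_term n w σ‖ :=
    (hasSum_jacobiTheta₂_term w hσ).summable.norm
  let e : (ℤ × ℤ) ⊕ (ℤ × ℤ) → ℤ × ℤ :=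
    Sum.elim (fun p ↦ (p.1 + p.2, p.1 - p.2)) (fun p ↦ (p.1 + p.2 + 1, p.1 - p.2))
  have he : Function.Bijective e := by
    constructor
    · rintro (⟨a, b⟩ | ⟨a, b⟩) (⟨c, d⟩ | ⟨c, d⟩) h <;> simp [e] at h ⊢ <;> omega
    · rintro ⟨m, n⟩
      rcases Int.even_or_odd' (m + n) with ⟨k, hk | hk⟩
      · exact ⟨.inl (k, m - k), by simp [e]; omega⟩
      · exact ⟨.inr (k, m - k - 1), by simp [e]; omega⟩
  simp only [jacobiTheta₂]
  rw [tsum_mul_tsum_of_summable_norm (hs x hτ) (hs y hτ),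
    tsum_mul_tsum_of_summable_norm (hs (x + y) hτ₂) (hs (x - y) hτ₂),
    tsum_mul_tsum_of_summable_norm (hs (x + y + τ) hτ₂) (hs (x - y + τ) hτ₂),
    ← (Equiv.ofBijective e he).tsum_eq, ← tsum_mul_left]
  have hsum := ((Equiv.ofBijective e he).summable_iff).mpr
    (summable_mul_of_summable_norm (hs x hτ) (hs y hτ))
  refine (Summable.tsum_sum (hsum.comp_injective Sum.inl_injective)
    (hsum.comp_injective Sum.inr_injective)).trans ?_
  have hl (p : ℤ × ℤ) : Equiv.ofBijective e he (.inl p) = (p.1 + p.2, p.1 - p.2) := rfl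
  have hr (p : ℤ × ℤ) : Equiv.ofBijective e he (.inr p) = (p.1 + p.2 + 1, p.1 - p.2) := rfl
  congr 1 <;> refine tsum_congr fun p ↦ ?_ <;>
    simp only [hl, hr, Function.comp_apply, jacobiTheta₂_term, ← Complex.exp_add] <;>
    congr 1 <;> push_cast <;> ring

theorem jacobiTheta₂_neg_half_add_half_period {τ : ℂ} : jacobiTheta₂ (-1 / 2 + τ / 2) τ = 0 := by
  have h1 := jacobiTheta₂_add_left' (-1 / 2 - τ / 2) τ
  have h2 : jacobiTheta₂ (-1 / 2 - τ / 2) τ = jacobiTheta₂ (-1 / 2 + τ / 2) τ := by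
    rw [← jacobiTheta₂_add_left, ← jacobiTheta₂_neg_left]
    ring_nf
  have h3 : -(Real.pi : ℂ) * Complex.I * (τ + 2 * (-1 / 2 - τ / 2)) = Real.pi * Complex.I := by
    ring
  rw [h2, h3, Complex.exp_pi_mul_I,
    show -1 / 2 - τ / 2 + τ = -1 / 2 + τ / 2 by ring] at h1
  linear_combination h1 / 2

theorem jacobiTheta₂_mul_add_half (u : ℂ) {τ : ℂ} (hτ : 0 < τ.im) :
    jacobiTheta₂ u τ * jacobiTheta₂ (u + 1 / 2) τ =
      jacobiTheta₂ (2 * u + 1 / 2) (2 * τ) * jacobiTheta₂ (1 / 2) (2 * τ) := by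
  have h := jacobiTheta₂_neg_half_add_half_period (τ := 2 * τ)
  rw [jacobiTheta₂_mul_jacobiTheta₂ _ _ hτ, ← jacobiTheta₂_neg_left (1 / 2),
    show u - (u + 1 / 2) + τ = -1 / 2 + 2 * τ / 2 by ring, h,
    show u - (u + 1 / 2) = -(1 / 2) by ring, show u + (u + 1 / 2) = 2 * u + 1 / 2 by ring]
  ring

theorem jacobiTheta₂_add_half_period_mul (u : ℂ) {τ : ℂ} (hτ : 0 < τ.im) :
    jacobiTheta₂ (u + 1 / 2 + τ / 2) τ * jacobiTheta₂ (u + τ / 2) τ =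
      jacobiTheta₂ (2 * u + 1 / 2 + τ) (2 * τ) * jacobiTheta₂ (1 / 2) (2 * τ) := by
  have h := jacobiTheta₂_mul_add_half (u + τ / 2) hτ
  rw [show u + τ / 2 + 1 / 2 = u + 1 / 2 + τ / 2 by ring,
    show 2 * (u + τ / 2) + 1 / 2 = 2 * u + 1 / 2 + τ by ring] at h
  rw [← h, mul_comm]

theorem jacobiTheta₂_mul_half_period (v : ℂ) {τ : ℂ} (hτ : 0 < τ.im) :
    jacobiTheta₂ (v + 1 / 2 + τ / 2) τ * jacobiTheta₂ (τ / 2) τ =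
      2 * (jacobiTheta₂ (v + 1 / 2 + τ) (2 * τ) * jacobiTheta₂ (v + 1 / 2) (2 * τ)) := by
  have h := jacobiTheta₂_add_left' (v + 1 / 2) (2 * τ)
  have hexp : Complex.exp (2 * Real.pi * Complex.I * (v + 1 / 2 + τ / 2) +
      Real.pi * Complex.I * τ) *
        Complex.exp (-Real.pi * Complex.I * (2 * τ + 2 * (v + 1 / 2))) = 1 := by
    rw [← Complex.exp_add, ← Complex.exp_zero]
    congr 1
    ring
  rw [jacobiTheta₂_mul_jacobiTheta₂ _ _ hτ,
    show v + 1 / 2 + τ / 2 + τ / 2 + τ = v + 1 / 2 + 2 * τ by ring, h,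
    show v + 1 / 2 + τ / 2 + τ / 2 = v + 1 / 2 + τ by ring,
    show v + 1 / 2 + τ / 2 - τ / 2 = v + 1 / 2 by ring]
  linear_combination
    jacobiTheta₂ (v + 1 / 2 + τ) (2 * τ) * jacobiTheta₂ (v + 1 / 2) (2 * τ) * hexp

/-- Duplication formula for `jacobiTheta₂`, in a form free of divisions. -/
theorem jacobiTheta₂_duplication (u : ℂ) {τ : ℂ} (hτ : 0 < τ.im) :
    jacobiTheta₂ (2 * u + 1 / 2 + τ / 2) τ *
        (jacobiTheta₂ (τ / 2) τ * jacobiTheta₂ 0 τ * jacobiTheta₂ (1 / 2) τ) =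
      2 * (jacobiTheta₂ (u + 1 / 2 + τ / 2) τ * jacobiTheta₂ (u + τ / 2) τ *
        jacobiTheta₂ u τ * jacobiTheta₂ (u + 1 / 2) τ) := by
  have h1 := jacobiTheta₂_mul_half_period (2 * u) hτ
  have h2 := jacobiTheta₂_mul_add_half 0 hτ
  have h3 := jacobiTheta₂_mul_add_half u hτ
  have h4 := jacobiTheta₂_add_half_period_mul u hτ
  simp only [mul_zero, zero_add] at h2
  calc _ = (jacobiTheta₂ (2 * u + 1 / 2 + τ / 2) τ * jacobiTheta₂ (τ / 2) τ) *
        (jacobiTheta₂ 0 τ * jacobiTheta₂ (1 / 2) τ) := by ring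
    _ = 2 * ((jacobiTheta₂ (u + 1 / 2 + τ / 2) τ * jacobiTheta₂ (u + τ / 2) τ) *
        (jacobiTheta₂ u τ * jacobiTheta₂ (u + 1 / 2) τ)) := by rw [h1, h2, h3, h4]; ring
    _ = _ := by ring

/-- The zeroth Fourier coefficient of `jacobiTheta₂` is `1`, so it is not identically zero. -/
theorem exists_jacobiTheta₂_ne_zero {τ : ℂ} (hτ : 0 < τ.im) : ∃ z, jacobiTheta₂ z τ ≠ 0 := by
  by_contra! h
  let f (n : ℤ) : C(ℝ, ℂ) := ⟨fun x ↦ jacobiTheta₂_term n x τ, by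
    unfold jacobiTheta₂_term; fun_prop⟩
  have hf (n : ℤ) (x : ℝ) : f n x = jacobiTheta₂_term n 0 τ *
      Complex.exp (2 * Real.pi * Complex.I * n * x) := by
    simp only [f, ContinuousMap.coe_mk, jacobiTheta₂_term, ← Complex.exp_add]
    congr 1
    ring
  have hsum := intervalIntegral.hasSum_intervalIntegral_of_summable_norm (a := 0) (b := 1)
    (f := f) <| (hasSum_jacobiTheta₂_term 0 hτ).summable.norm.of_nonneg_of_le
      (fun _ ↦ norm_nonneg _) fun n ↦ by
        refine (ContinuousMap.norm_le _ (norm_nonneg _)).mpr fun x ↦ ?_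
        rw [ContinuousMap.restrict_apply, hf, norm_mul,
          show 2 * (Real.pi : ℂ) * Complex.I * n * (x : ℝ) =
            ((2 * Real.pi * n * (x : ℝ) : ℝ) : ℂ) * Complex.I by push_cast; ring,
          Complex.norm_exp_ofReal_mul_I, mul_one]
  have hzero (x : ℝ) : ∑' n, f n x = 0 := h x
  simp only [hzero, intervalIntegral.integral_zero] at hsum
  have hint (n : ℤ) (hn : n ≠ 0) : ∫ x in (0 : ℝ)..1, f n x = 0 := by
    simp only [hf, intervalIntegral.integral_const_mul]
    rw [integral_exp_mul_complex (by simp [hn, Real.pi_ne_zero])]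
    have := Complex.exp_int_mul_two_pi_mul_I n
    rw [show 2 * (Real.pi : ℂ) * Complex.I * n * (1 : ℝ) = n * (2 * Real.pi * Complex.I) by
      push_cast; ring, this]
    simp
  have h0 := hsum.unique (hasSum_single 0 hint)
  simp [f, jacobiTheta₂_term] at h0

theorem jacobiTheta₂_constants_ne_zero {τ : ℂ} (hτ : 0 < τ.im) :
    jacobiTheta₂ (τ / 2) τ * jacobiTheta₂ 0 τ * jacobiTheta₂ (1 / 2) τ ≠ 0 := by
  intro h0
  obtain ⟨z, hz⟩ := exists_jacobiTheta₂_ne_zero hτ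
  have han (c : ℂ) : AnalyticOnNhd ℂ (fun u ↦ jacobiTheta₂ (u + c) τ) Set.univ := by
    refine DifferentiableOn.analyticOnNhd (fun u _ ↦ ?_) isOpen_univ
    exact ((differentiableAt_jacobiTheta₂_fst (u + c) hτ).comp u
      (by fun_prop : DifferentiableAt ℂ (fun u ↦ u + c) u)).differentiableWithinAt
  have hne (c : ℂ) : ¬ ∀ u ∈ Set.univ, jacobiTheta₂ (u + c) τ = 0 := fun h ↦
    hz (by simpa using h (z - c) trivial)
  have hprod : ∀ u ∈ Set.univ, (jacobiTheta₂ (u + (1 / 2 + τ / 2)) τ *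
      jacobiTheta₂ (u + τ / 2) τ) * (jacobiTheta₂ (u + 0) τ * jacobiTheta₂ (u + 1 / 2) τ) = 0 := by
    intro u _
    have h := jacobiTheta₂_duplication u hτ
    rw [h0, mul_zero] at h
    rw [← add_assoc, add_zero]
    linear_combination -h / 2
  rcases AnalyticOnNhd.eq_zero_or_eq_zero_of_mul_eq_zero ((han _).mul (han _))
    ((han _).mul (han _)) hprod isPreconnected_univ with h | h <;>
  rcases AnalyticOnNhd.eq_zero_or_eq_zero_of_mul_eq_zero (han _) (han _) h
    isPreconnected_univ with h | h <;> exact hne _ h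

theorem theta1_eq_jacobiTheta₂ (u : ℂ) {τ : ℂ} (hτ : 0 < τ.im) :
    theta1 (Real.pi * u) τ = -Complex.I * Complex.exp (Real.pi * Complex.I * (τ / 4 + u)) *
      jacobiTheta₂ (u + 1 / 2 + τ / 2) τ := by
  have h := ((hasSum_jacobiTheta₂_term (u + 1 / 2 + τ / 2) hτ).mul_left
    (-Complex.I * Complex.exp (Real.pi * Complex.I * (τ / 4 + u)))).nat_add_neg_add_one
  rw [theta1, ← h.tsum_eq, ← tsum_mul_left]
  refine tsum_congr fun n ↦ ?_
  have hn : Complex.exp (Real.pi * Complex.I * n) = (-1) ^ n := by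
    rw [mul_comm, Complex.exp_nat_mul, Complex.exp_pi_mul_I]
  have hn' : Complex.exp (-(Real.pi * Complex.I * (n + 1))) = -(-1) ^ n := by
    rw [Complex.exp_neg, mul_add, Complex.exp_add, hn, mul_one, Complex.exp_pi_mul_I]
    rcases neg_one_pow_eq_or ℂ n with h | h <;> rw [h] <;> norm_num
  have e1 : Complex.exp (Real.pi * Complex.I * (τ / 4 + u)) *
      jacobiTheta₂_term n (u + 1 / 2 + τ / 2) τ =
      (-1) ^ n * Complex.exp (Real.pi * Complex.I * τ * ((n : ℂ) + 1 / 2) ^ 2) *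
        Complex.exp ((2 * (n : ℂ) + 1) * (Real.pi * u) * Complex.I) := by
    rw [← hn, jacobiTheta₂_term]
    simp only [← Complex.exp_add]
    congr 1
    push_cast
    ring
  have e2 : Complex.exp (Real.pi * Complex.I * (τ / 4 + u)) *
      jacobiTheta₂_term (-(n + 1)) (u + 1 / 2 + τ / 2) τ =
      -(-1) ^ n * Complex.exp (Real.pi * Complex.I * τ * ((n : ℂ) + 1 / 2) ^ 2) *
        Complex.exp (-((2 * (n : ℂ) + 1) * (Real.pi * u)) * Complex.I) := by
    rw [← hn', jacobiTheta₂_term]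
    simp only [← Complex.exp_add]
    congr 1
    push_cast
    ring
  rw [mul_assoc (-Complex.I), mul_assoc (-Complex.I), e1, e2, Complex.sin]
  ring

theorem theta2_eq_jacobiTheta₂ (u : ℂ) {τ : ℂ} (hτ : 0 < τ.im) :
    theta2 (Real.pi * u) τ = Complex.exp (Real.pi * Complex.I * (τ / 4 + u)) *
      jacobiTheta₂ (u + τ / 2) τ := by
  have h := ((hasSum_jacobiTheta₂_term (u + τ / 2) hτ).mul_left
    (Complex.exp (Real.pi * Complex.I * (τ / 4 + u)))).nat_add_neg_add_one
  rw [theta2, ← h.tsum_eq, ← tsum_mul_left]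
  refine tsum_congr fun n ↦ ?_
  rw [Complex.cos, mul_left_comm, mul_div_cancel₀ _ two_ne_zero, mul_add]
  simp only [jacobiTheta₂_term, ← Complex.exp_add]
  congr 2 <;> push_cast <;> ring

theorem theta3_eq_jacobiTheta₂ (u : ℂ) {τ : ℂ} (hτ : 0 < τ.im) :
    theta3 (Real.pi * u) τ = jacobiTheta₂ u τ := by
  have h := (hasSum_nat_add_iff' 1).mpr (hasSum_jacobiTheta₂_term u hτ).nat_add_neg
  have h0 : jacobiTheta₂_term 0 u τ = 1 := by simp [jacobiTheta₂_term]
  simp only [Finset.sum_range_one, Nat.cast_zero, neg_zero, h0] at h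
  rw [theta3, ← tsum_mul_left, ← eq_sub_iff_add_eq', show jacobiTheta₂ u τ - 1 =
    jacobiTheta₂ u τ + 1 - (1 + 1) by ring, ← h.tsum_eq]
  refine tsum_congr fun n ↦ ?_
  rw [Complex.cos, mul_left_comm, mul_div_cancel₀ _ two_ne_zero, mul_add]
  simp only [jacobiTheta₂_term, ← Complex.exp_add]
  congr 2 <;> push_cast <;> ring

theorem theta4_eq_jacobiTheta₂ (u : ℂ) {τ : ℂ} (hτ : 0 < τ.im) :
    theta4 (Real.pi * u) τ = jacobiTheta₂ (u + 1 / 2) τ := by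
  rw [← theta3_eq_jacobiTheta₂ _ hτ, theta3, theta4]
  congr 2
  refine tsum_congr fun n ↦ ?_
  rw [show 2 * ((n : ℂ) + 1) * (Real.pi * (u + 1 / 2)) =
    2 * ((n : ℂ) + 1) * (Real.pi * u) + ((n + 1 : ℕ) : ℂ) * Real.pi by push_cast; ring,
    Complex.cos_antiperiodic.add_nat_mul_eq]
  ring

/-- Duplication: θ₁(2z|τ) = (2/(θ₂(0|τ)θ₃(0|τ)θ₄(0|τ))) θ₁(z|τ)θ₂(z|τ)θ₃(z|τ)θ₄(z|τ). -/
theorem theta1_two_mul (τ : ℂ) (hτ : 0 < τ.im) (z : ℂ) :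
    theta1 (2 * z) τ =
      2 / (theta2 0 τ * theta3 0 τ * theta4 0 τ) *
        (theta1 z τ * theta2 z τ * theta3 z τ * theta4 z τ) := by
  obtain ⟨u, rfl⟩ : ∃ u : ℂ, z = Real.pi * u :=
    ⟨z / Real.pi, by field_simp⟩
  have h2 := theta2_eq_jacobiTheta₂ 0 hτ
  have h3 := theta3_eq_jacobiTheta₂ 0 hτ
  have h4 := theta4_eq_jacobiTheta₂ 0 hτ
  simp only [mul_zero, zero_add, add_zero] at h2 h3 h4
  have hne := jacobiTheta₂_constants_ne_zero hτ
  have hc : theta2 0 τ * theta3 0 τ * theta4 0 τ =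
      Complex.exp (Real.pi * Complex.I * (τ / 4)) *
        (jacobiTheta₂ (τ / 2) τ * jacobiTheta₂ 0 τ * jacobiTheta₂ (1 / 2) τ) := by
    rw [h2, h3, h4]
    ring
  have hc0 : theta2 0 τ * theta3 0 τ * theta4 0 τ ≠ 0 := by
    rw [hc]
    exact mul_ne_zero (Complex.exp_ne_zero _) hne
  rw [div_mul_eq_mul_div, eq_div_iff hc0, hc, mul_left_comm 2 (Real.pi : ℂ),
    theta1_eq_jacobiTheta₂ _ hτ, theta1_eq_jacobiTheta₂ _ hτ, theta2_eq_jacobiTheta₂ _ hτ,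
    theta3_eq_jacobiTheta₂ _ hτ, theta4_eq_jacobiTheta₂ _ hτ]
  have hexp : Complex.exp (Real.pi * Complex.I * (τ / 4 + 2 * u)) *
      Complex.exp (Real.pi * Complex.I * (τ / 4)) =
      Complex.exp (Real.pi * Complex.I * (τ / 4 + u)) *
        Complex.exp (Real.pi * Complex.I * (τ / 4 + u)) := by
    simp only [← Complex.exp_add]
    congr 1
    ring
  have hdup := jacobiTheta₂_duplication u hτ
  linear_combination
    2 * Complex.I * jacobiTheta₂ (u + 1 / 2 + τ / 2) τ * jacobiTheta₂ (u + τ / 2) τ *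
      jacobiTheta₂ u τ * jacobiTheta₂ (u + 1 / 2) τ * (-1) * hexp +
    (-Complex.I * Complex.exp (Real.pi * Complex.I * (τ / 4 + 2 * u)) *
      Complex.exp (Real.pi * Complex.I * (τ / 4))) * hdup
end

section
/- (Theorem 3, odd case) Fix τ ∈ ℂ with Im τ > 0 and an integer l ≥ 1; set n = 2l+1. Then for every z ∈ ℂ, θ₁(nz|τ) = C · ∏_{k=-l}^{l} ∏_{j=-l}^{l} θ₁(z + kπ/n + jπτ/n | τ), where C is the nonzero constant determined by C⁻¹ = (1/n) · ∏_{(k,j)∈{-l,…,l}², (k,j)≠(0,0)} θ₁(kπ/n + jπτ/n | τ). -/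
open Complex Filter Topology

/-- The integral of an entire function with period `1` over a horizontal segment of length `1`
does not depend on the segment. -/
lemma integral_add_eq_of_periodic_one {F : ℂ → ℂ} (hF : Differentiable ℂ F)
    (hper : ∀ w, F (w + 1) = F w) (s : ℂ) :
    ∫ x in (0 : ℝ)..1, F (x + s) = ∫ x in (0 : ℝ)..1, F x := by
  obtain ⟨G, hG⟩ := (hF.differentiableOn (s := Metric.ball 0 (‖s‖ + 2))).isExactOn_ball
  have key : ∀ a ∈ Metric.ball (0 : ℂ) (‖s‖ + 2), ∀ b ∈ Metric.ball (0 : ℂ) (‖s‖ + 2),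
      (b - a) * ∫ t in (0 : ℝ)..1, F (a + t * (b - a)) = G b - G a := by
    intro a ha b hb
    have hd : ∀ t ∈ Set.uIcc (0 : ℝ) 1,
        HasDerivAt (fun t : ℝ ↦ G (a + t * (b - a))) ((b - a) * F (a + t * (b - a))) t := by
      intro t ht
      rw [Set.uIcc_of_le zero_le_one] at ht
      have hmem := (convex_ball (0 : ℂ) (‖s‖ + 2)).add_smul_sub_mem ha hb ht
      have hlin : HasDerivAt (fun t : ℝ ↦ a + t * (b - a)) (b - a) t := by
        simpa using ((hasDerivAt_id t).ofReal_comp.mul_const (b - a)).const_add a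
      have hG' := hG (a + t * (b - a)) (by simpa using hmem)
      simpa [mul_comm] using! hG'.comp t hlin
    have hint := intervalIntegral.integral_eq_sub_of_hasDerivAt hd
      (Continuous.intervalIntegrable
        (continuous_const.mul (hF.continuous.comp (by fun_prop))) _ _)
    rw [intervalIntegral.integral_const_mul] at hint
    simpa using hint
  have h0 : (0 : ℂ) ∈ Metric.ball (0 : ℂ) (‖s‖ + 2) := by simp; positivity
  have h1 : (1 : ℂ) ∈ Metric.ball (0 : ℂ) (‖s‖ + 2) := by
    simp; linarith [norm_nonneg s]
  have h2 : s ∈ Metric.ball (0 : ℂ) (‖s‖ + 2) := by simp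
  have h3 : 1 + s ∈ Metric.ball (0 : ℂ) (‖s‖ + 2) := by
    have := norm_add_le 1 s
    simp at this ⊢; linarith
  have e1 := key 0 h0 1 h1
  have e2 := key s h2 (1 + s) h3
  have e3 := key 0 h0 s h2
  have e4 := key 1 h1 (1 + s) h3
  simp only [sub_zero, zero_add, mul_one, one_mul, add_sub_cancel_right,
    add_sub_cancel_left, add_comm (1 : ℂ), hper] at e1 e2 e3 e4
  simp only [add_comm _ s]
  linear_combination e2 - e1 + e3 - e4

/-- A continuous function on `ℝ` of period `1` all of whose Fourier coefficients vanish is zero. -/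
lemma eq_zero_of_fourierIntegral_eq_zero {f : ℝ → ℂ} (hf : Continuous f)
    (hper : ∀ x, f (x + 1) = f x)
    (h : ∀ n : ℤ, ∫ x in (0 : ℝ)..1, f x * cexp (2 * Real.pi * I * n * x) = 0) (x : ℝ) :
    f x = 0 := by
  have hp : Function.Periodic f 1 := hper
  let g : C(AddCircle (1 : ℝ), ℂ) :=
    ⟨hp.lift, continuous_coinduced_dom.mpr hf⟩
  have hg : ∀ n, fourierCoeff g n = 0 := by
    intro n
    rw [fourierCoeff_eq_intervalIntegral g n 0]
    have := h (-n)
    simp only [zero_add, div_one, one_smul]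
    rw [← this]
    refine intervalIntegral.integral_congr fun x _ ↦ ?_
    simp only [fourier_coe_apply, smul_eq_mul, g, ContinuousMap.coe_mk, Function.Periodic.lift_coe]
    rw [mul_comm]
    simp
  have hs := has_pointwise_sum_fourier_series_of_summable (f := g)
    (by simp [funext hg]) (x : AddCircle (1 : ℝ))
  simp only [hg, zero_smul] at hs
  exact (hs.unique hasSum_zero)

/-- An entire function with `h (w + 1) = h w` and `h (w + τ) = -exp (-2πiw) h w` whose mean over
a period vanishes is zero. -/
lemma eq_zero_of_quasiperiodic {τ : ℂ} {h : ℂ → ℂ} (hd : Differentiable ℂ h)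
    (h1 : ∀ w, h (w + 1) = h w)
    (h2 : ∀ w, h (w + τ) = -cexp (-(2 * Real.pi * I * w)) * h w)
    (h0 : ∫ x in (0 : ℝ)..1, h x = 0) (w : ℂ) : h w = 0 := by
  have step : ∀ n : ℤ, ∫ x in (0 : ℝ)..1, h x * cexp (2 * Real.pi * I * n * x) =
      -cexp (2 * Real.pi * I * n * τ) *
        ∫ x in (0 : ℝ)..1, h x * cexp (2 * Real.pi * I * (n - 1 : ℤ) * x) := by
    intro n
    have := integral_add_eq_of_periodic_one (F := fun w ↦ h w * cexp (2 * Real.pi * I * n * w))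
      (by fun_prop) (fun w ↦ by
        rw [h1, show 2 * Real.pi * I * n * (w + 1) = 2 * Real.pi * I * n * w
          + n * (2 * Real.pi * I) by ring, exp_periodic.int_mul]) τ
    rw [← this, ← intervalIntegral.integral_const_mul]
    refine intervalIntegral.integral_congr fun x _ ↦ ?_
    simp only [h2]
    have : cexp (2 * Real.pi * I * n * (x + τ)) * cexp (-(2 * Real.pi * I * x)) =
        cexp (2 * Real.pi * I * n * τ) * cexp (2 * Real.pi * I * (n - 1 : ℤ) * x) := by
      rw [← exp_add, ← exp_add]; push_cast; ring_nf
    linear_combination (-h x) * this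
  have hall : ∀ n : ℤ, ∫ x in (0 : ℝ)..1, h x * cexp (2 * Real.pi * I * n * x) = 0 := by
    intro n
    induction n using Int.induction_on with
    | zero => simpa using h0
    | succ n ih => rw [step, add_sub_cancel_right, ih, mul_zero]
    | pred n ih =>
      rw [step] at ih
      exact (mul_eq_zero.mp ih).resolve_left (neg_ne_zero.mpr (exp_ne_zero _))
  have hreal := eq_zero_of_fourierIntegral_eq_zero (f := fun x : ℝ ↦ h x)
    (hd.continuous.comp continuous_ofReal) (fun x ↦ by simp [h1]) hall
  have han : AnalyticOnNhd ℂ h Set.univ := hd.differentiableOn.analyticOnNhd isOpen_univ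
  refine han.eqOn_zero_of_preconnected_of_frequently_eq_zero isPreconnected_univ
    (Set.mem_univ 0) ?_ (Set.mem_univ w)
  have ht : Tendsto (fun x : ℝ ↦ (x : ℂ)) (𝓝[≠] 0) (𝓝[≠] 0) := by
    refine tendsto_nhdsWithin_iff.mpr ⟨?_, ?_⟩
    · exact (continuous_ofReal.tendsto' 0 0 (by simp)).mono_left nhdsWithin_le_nhds
    · filter_upwards [self_mem_nhdsWithin] with x hx using by simpa using hx
  exact ht.frequently (Frequently.of_forall hreal)

/-- The space of entire functions with `h (w + 1) = h w` and `h (w + τ) = -exp (-2πiw) h w`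
is at most one-dimensional. -/
lemma exists_eq_const_mul_of_quasiperiodic {τ : ℂ} {g h : ℂ → ℂ}
    (hgd : Differentiable ℂ g) (hg1 : ∀ w, g (w + 1) = g w)
    (hg2 : ∀ w, g (w + τ) = -cexp (-(2 * Real.pi * I * w)) * g w)
    (hd : Differentiable ℂ h) (h1 : ∀ w, h (w + 1) = h w)
    (h2 : ∀ w, h (w + τ) = -cexp (-(2 * Real.pi * I * w)) * h w)
    (hg : ∃ w, g w ≠ 0) : ∃ c, ∀ w, h w = c * g w := by
  set b := ∫ x in (0 : ℝ)..1, g x with hb_def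
  have hb : b ≠ 0 := by
    intro hb
    obtain ⟨w, hw⟩ := hg
    exact hw (eq_zero_of_quasiperiodic hgd hg1 hg2 hb w)
  refine ⟨(∫ x in (0 : ℝ)..1, h x) / b, fun w ↦ ?_⟩
  set c := (∫ x in (0 : ℝ)..1, h x) / b with hc
  have := eq_zero_of_quasiperiodic (τ := τ) (h := fun w ↦ h w - c * g w) (by fun_prop)
    (fun w ↦ by simp only [h1, hg1]) (fun w ↦ by simp only [h2, hg2]; ring)
    (by
      rw [intervalIntegral.integral_sub, intervalIntegral.integral_const_mul, ← hb_def, hc,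
        div_mul_cancel₀ _ hb, sub_self]
      · exact (hd.continuous.comp continuous_ofReal).intervalIntegrable _ _
      · exact ((hgd.continuous.comp continuous_ofReal).const_mul c).intervalIntegrable _ _) w
  exact sub_eq_zero.mp this

/-- For `0 < im τ`, `jacobiTheta₂ · τ` has mean `1` over a period. -/
lemma integral_jacobiTheta₂ {τ : ℂ} (hτ : 0 < τ.im) :
    ∫ x in (0 : ℝ)..1, jacobiTheta₂ x τ = 1 := by
  let f : ℤ → C(ℝ, ℂ) := fun n ↦
    ⟨fun x ↦ jacobiTheta₂_term n x τ, by unfold jacobiTheta₂_term; fun_prop⟩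
  have hsum : Summable fun n ↦
      ‖(f n).restrict (⟨Set.uIcc 0 1, isCompact_uIcc⟩ : TopologicalSpace.Compacts ℝ)‖ := by
    refine Summable.of_nonneg_of_le (fun _ ↦ norm_nonneg _) (fun n ↦ ?_)
      ((summable_jacobiTheta₂_term_iff 0 τ).mpr hτ).norm
    refine (ContinuousMap.norm_le _ (norm_nonneg _)).mpr fun x ↦ ?_
    simp [f, norm_jacobiTheta₂_term]
  have h := intervalIntegral.hasSum_intervalIntegral_of_summable_norm (a := 0) (b := 1) hsum
  refine h.unique ?_
  have hval : ∀ n : ℤ, ∫ x in (0 : ℝ)..1, f n x = if n = 0 then 1 else 0 := by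
    intro n
    simp only [f, ContinuousMap.coe_mk, jacobiTheta₂_term, Complex.exp_add]
    rw [intervalIntegral.integral_mul_const]
    split_ifs with hn
    · simp [hn]
    · rw [integral_exp_mul_complex (by simp [hn, Real.pi_ne_zero])]
      have : cexp (2 * Real.pi * I * n) = 1 := by
        rw [show 2 * Real.pi * I * n = n * (2 * Real.pi * I) by ring, exp_int_mul_two_pi_mul_I]
      simp [this]
  simp only [hval]
  exact hasSum_ite_eq 0 1

/-- The infinite product `∏ (1 - p ^ (n + 1) u)` as a function of `u`. -/
noncomputable def eulerProd (p u : ℂ) : ℂ := ∏' n : ℕ, (1 + -(p ^ (n + 1) * u))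

lemma summable_norm_eulerProd {p : ℂ} (hp : ‖p‖ < 1) (u : ℂ) :
    Summable fun n : ℕ ↦ ‖-(p ^ (n + 1) * u)‖ := by
  simp only [norm_neg, norm_mul, norm_pow]
  exact ((summable_nat_add_iff 1).mpr
    (summable_geometric_of_lt_one (norm_nonneg _) hp)).mul_right _

lemma differentiable_eulerProd {p : ℂ} (hp : ‖p‖ < 1) : Differentiable ℂ (eulerProd p) := by
  intro u
  have hu : u ∈ Metric.ball (0 : ℂ) (‖u‖ + 1) := by simp
  have h := Summable.hasProdLocallyUniformlyOn_nat_one_add (f := fun n u ↦ -(p ^ (n + 1) * u))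
    (K := Metric.ball (0 : ℂ) (‖u‖ + 1)) Metric.isOpen_ball
    (((summable_nat_add_iff 1).mpr
      (summable_geometric_of_lt_one (norm_nonneg p) hp)).mul_right (‖u‖ + 1))
    (Eventually.of_forall fun n x hx ↦ by
      simp only [norm_neg, norm_mul, norm_pow]
      gcongr
      exact (mem_ball_zero_iff.mp hx).le) (fun n ↦ by fun_prop)
  have hd := h.differentiableOn (Eventually.of_forall fun s ↦ by
    fun_prop) Metric.isOpen_ball
  exact hd.differentiableAt (Metric.isOpen_ball.mem_nhds hu)

lemma eulerProd_eq_mul {p : ℂ} (hp : ‖p‖ < 1) (u : ℂ) :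
    eulerProd p u = (1 - p * u) * eulerProd p (p * u) := by
  unfold eulerProd
  rw [tprod_eq_zero_mul' (f := fun n : ℕ ↦ 1 + -(p ^ (n + 1) * u)) (multipliable_one_add_of_summable (by
    simpa [pow_succ, mul_assoc] using summable_norm_eulerProd hp (p * u)))]
  simp only [zero_add, pow_one, ← sub_eq_add_neg]
  congr 1
  exact tprod_congr fun n ↦ by ring

lemma eulerProd_one_ne_zero {p : ℂ} (hp : ‖p‖ < 1) : eulerProd p 1 ≠ 0 := by
  refine tprod_one_add_ne_zero_of_summable (fun n h ↦ ?_) (summable_norm_eulerProd hp 1)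
  have h1 : p ^ (n + 1) = 1 := by linear_combination -h
  have h2 : ‖p‖ ^ (n + 1) < 1 := pow_lt_one₀ (norm_nonneg _) hp n.succ_ne_zero
  rw [← norm_pow, h1, norm_one] at h2
  exact lt_irrefl _ h2

/-- An entire function with `h (w + 1) = h w` and `h (w + τ) = -exp (-2πiw) h w` having a simple
zero at the origin (the product side of the Jacobi triple product). -/
lemma exists_quasiperiodic_deriv_ne_zero {τ : ℂ} (hτ : 0 < τ.im) :
    ∃ h : ℂ → ℂ, Differentiable ℂ h ∧ (∀ w, h (w + 1) = h w) ∧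
      (∀ w, h (w + τ) = -cexp (-(2 * Real.pi * I * w)) * h w) ∧ deriv h 0 ≠ 0 := by
  set p := cexp (2 * Real.pi * I * τ) with hp_def
  have hp : ‖p‖ < 1 := UpperHalfPlane.norm_exp_two_pi_I_lt_one ⟨τ, hτ⟩
  have hA := differentiable_eulerProd hp
  set B : ℂ → ℂ := fun w ↦ eulerProd p (cexp (2 * Real.pi * I * w)) *
    eulerProd p (cexp (-(2 * Real.pi * I * w))) with hB
  have hBd : Differentiable ℂ B := (hA.comp (by fun_prop)).mul (hA.comp (by fun_prop))
  refine ⟨fun w ↦ (1 - cexp (2 * Real.pi * I * w)) * B w, by fun_prop, fun w ↦ ?_, fun w ↦ ?_, ?_⟩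
  · have e1 : cexp (2 * Real.pi * I * (w + 1)) = cexp (2 * Real.pi * I * w) := by
      rw [mul_add, mul_one, exp_periodic]
    simp only [hB, exp_neg, e1]
  · have e1 : cexp (2 * Real.pi * I * (w + τ)) = p * cexp (2 * Real.pi * I * w) := by
      rw [mul_add, exp_add, mul_comm]
    have e2 : cexp (-(2 * Real.pi * I * w)) = p * cexp (-(2 * Real.pi * I * (w + τ))) := by
      rw [hp_def, ← exp_add]; ring_nf
    have e3 : cexp (2 * Real.pi * I * w) * cexp (-(2 * Real.pi * I * w)) = 1 := by
      rw [← exp_add]; simp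
    have a1 := eulerProd_eq_mul hp (cexp (2 * Real.pi * I * w))
    have a2 := eulerProd_eq_mul hp (cexp (-(2 * Real.pi * I * (w + τ))))
    rw [← e2] at a2
    simp only [hB, e1]
    rw [a2, a1]
    linear_combination -(1 - p * cexp (2 * Real.pi * I * w)) *
      eulerProd p (p * cexp (2 * Real.pi * I * w)) * eulerProd p (cexp (-(2 * Real.pi * I * w))) * e3
  · have h1 : HasDerivAt (fun w ↦ 1 - cexp (2 * Real.pi * I * w)) (-(2 * Real.pi * I)) 0 := by
      have : HasDerivAt (fun w : ℂ ↦ 2 * Real.pi * I * w) (2 * Real.pi * I) 0 := by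
        simpa using (hasDerivAt_id (0 : ℂ)).const_mul (2 * Real.pi * I)
      simpa using this.cexp.const_sub 1
    have h2 := (h1.mul (hBd 0).hasDerivAt).deriv
    have h3 : B 0 = eulerProd p 1 * eulerProd p 1 := by simp [hB]
    change deriv ((fun w ↦ 1 - cexp (2 * Real.pi * I * w)) * B) 0 ≠ 0
    rw [h2, h3]
    simp [eulerProd_one_ne_zero hp, Real.pi_ne_zero]

/-- `θ₁` in terms of Mathlib's two-variable theta function. -/
lemma exp_mul_theta1 {τ : ℂ} (hτ : 0 < τ.im) (z : ℂ) :
    cexp (I * z) * theta1 z τ =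
      I * cexp (Real.pi * I * τ / 4) * jacobiTheta₂ (z / Real.pi + (1 - τ) / 2) τ := by
  have hπ : (Real.pi : ℂ) ≠ 0 := by exact_mod_cast Real.pi_ne_zero
  rw [← jacobiTheta₂_neg_left]
  have h := ((hasSum_jacobiTheta₂_term (-(z / Real.pi + (1 - τ) / 2)) hτ).nat_add_neg_add_one).tsum_eq
  rw [← h, theta1, ← mul_assoc, ← tsum_mul_left, ← tsum_mul_left]
  refine tsum_congr fun n ↦ ?_
  have hn : (-1 : ℂ) ^ n = cexp (-(Real.pi * I * n)) := by
    rw [← exp_neg_pi_mul_I, ← exp_nat_mul]; ring_nf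
  have hn' : -(-1 : ℂ) ^ n = cexp (Real.pi * I * (n + 1)) := by
    rw [mul_add, mul_one, exp_add, exp_pi_mul_I, mul_neg_one, ← exp_pi_mul_I, ← exp_nat_mul]
    ring_nf
  have e1 : cexp (Real.pi * I * τ / 4) * jacobiTheta₂_term n (-(z / Real.pi + (1 - τ) / 2)) τ =
      cexp (I * z) * ((-1) ^ n * cexp (Real.pi * I * τ * ((n : ℂ) + 1 / 2) ^ 2) *
        cexp (-((2 * n + 1) * z) * I)) := by
    rw [hn, jacobiTheta₂_term, ← exp_add, ← exp_add, ← exp_add, ← exp_add]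
    congr 1
    push_cast
    field_simp
    ring
  have e2 : cexp (Real.pi * I * τ / 4) *
      jacobiTheta₂_term (-(n + 1 : ℤ)) (-(z / Real.pi + (1 - τ) / 2)) τ =
      cexp (I * z) * (-(-1) ^ n * cexp (Real.pi * I * τ * ((n : ℂ) + 1 / 2) ^ 2) *
        cexp ((2 * n + 1) * z * I)) := by
    rw [hn', jacobiTheta₂_term, ← exp_add, ← exp_add, ← exp_add, ← exp_add]
    congr 1
    push_cast
    field_simp
    ring
  rw [mul_assoc I, mul_add, e1, e2, Complex.sin]
  ring

lemma theta1_eq {τ : ℂ} (hτ : 0 < τ.im) (z : ℂ) :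
    theta1 z τ = cexp (-(I * z)) *
      (I * cexp (Real.pi * I * τ / 4) * jacobiTheta₂ (z / Real.pi + (1 - τ) / 2) τ) := by
  rw [← exp_mul_theta1 hτ, ← mul_assoc, ← exp_add, neg_add_cancel, exp_zero, one_mul]

lemma differentiable_theta1 {τ : ℂ} (hτ : 0 < τ.im) : Differentiable ℂ fun z ↦ theta1 z τ := by
  simp only [theta1_eq hτ]
  have hJ : Differentiable ℂ fun z ↦ jacobiTheta₂ z τ :=
    fun z ↦ differentiableAt_jacobiTheta₂_fst z hτ
  have : Differentiable ℂ fun z : ℂ ↦ jacobiTheta₂ (z / Real.pi + (1 - τ) / 2) τ :=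
    hJ.comp (by fun_prop)
  fun_prop

lemma theta1_add_pi {τ : ℂ} (hτ : 0 < τ.im) (z : ℂ) :
    theta1 (z + Real.pi) τ = -theta1 z τ := by
  have hπ : (Real.pi : ℂ) ≠ 0 := by exact_mod_cast Real.pi_ne_zero
  rw [theta1_eq hτ, theta1_eq hτ, show (z + Real.pi) / Real.pi + (1 - τ) / 2 =
    z / Real.pi + (1 - τ) / 2 + 1 by field_simp; ring, jacobiTheta₂_add_left,
    show -(I * (z + Real.pi)) = -(I * z) + -(Real.pi * I) by ring, exp_add, exp_neg_pi_mul_I]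
  ring

lemma theta1_add_pi_mul {τ : ℂ} (hτ : 0 < τ.im) (z : ℂ) :
    theta1 (z + Real.pi * τ) τ = -cexp (-(Real.pi * I * τ) - 2 * I * z) * theta1 z τ := by
  have hπ : (Real.pi : ℂ) ≠ 0 := by exact_mod_cast Real.pi_ne_zero
  rw [theta1_eq hτ, theta1_eq hτ, show (z + Real.pi * τ) / Real.pi + (1 - τ) / 2 =
    z / Real.pi + (1 - τ) / 2 + τ by field_simp; ring, jacobiTheta₂_add_left']
  have : cexp (-(I * (z + Real.pi * τ))) *
      cexp (-Real.pi * I * (τ + 2 * (z / Real.pi + (1 - τ) / 2))) =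
      -cexp (-(Real.pi * I * τ) - 2 * I * z) * cexp (-(I * z)) := by
    rw [← neg_one_mul (cexp (-(Real.pi * I * τ) - 2 * I * z)), ← exp_neg_pi_mul_I, ← exp_add,
      ← exp_add, ← exp_add]
    congr 1
    field_simp
    ring
  linear_combination (I * cexp (Real.pi * I * τ / 4) *
    jacobiTheta₂ (z / Real.pi + (1 - τ) / 2) τ) * this

lemma theta1_zero (τ : ℂ) : theta1 0 τ = 0 := by simp [theta1]

lemma exists_theta1_ne_zero {τ : ℂ} (hτ : 0 < τ.im) : ∃ z, theta1 z τ ≠ 0 := by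
  have hπ : (Real.pi : ℂ) ≠ 0 := by exact_mod_cast Real.pi_ne_zero
  by_contra! h
  have hJ : ∀ x, jacobiTheta₂ x τ = 0 := by
    intro x
    have := exp_mul_theta1 hτ (Real.pi * (x - (1 - τ) / 2))
    rw [h, mul_zero, mul_div_cancel_left₀ _ hπ, sub_add_cancel] at this
    simpa using this.symm
  simpa [hJ] using integral_jacobiTheta₂ hτ

lemma exp_mul_quasiperiodic {τ : ℂ} {f : ℂ → ℂ}
    (h1 : ∀ z, f (z + Real.pi) = -f z)
    (h2 : ∀ z, f (z + Real.pi * τ) = -cexp (-(Real.pi * I * τ) - 2 * I * z) * f z) :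
    (∀ w, cexp (Real.pi * I * (w + 1)) * f (Real.pi * (w + 1)) =
      cexp (Real.pi * I * w) * f (Real.pi * w)) ∧
    (∀ w, cexp (Real.pi * I * (w + τ)) * f (Real.pi * (w + τ)) =
      -cexp (-(2 * Real.pi * I * w)) * (cexp (Real.pi * I * w) * f (Real.pi * w))) := by
  refine ⟨fun w ↦ ?_, fun w ↦ ?_⟩
  · rw [mul_add, mul_add, mul_one, mul_one, h1, exp_add, exp_pi_mul_I]
    ring
  · have : cexp (Real.pi * I * (w + τ)) * cexp (-(Real.pi * I * τ) - 2 * I * (Real.pi * w)) =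
        cexp (-(2 * Real.pi * I * w)) * cexp (Real.pi * I * w) := by
      rw [← exp_add, ← exp_add]; ring_nf
    rw [mul_add (Real.pi : ℂ) w τ, h2]
    linear_combination (-f (Real.pi * w)) * this

lemma exists_exp_mul_theta1_ne_zero {τ : ℂ} (hτ : 0 < τ.im) :
    ∃ w, cexp (Real.pi * I * w) * theta1 (Real.pi * w) τ ≠ 0 := by
  have hπ : (Real.pi : ℂ) ≠ 0 := by exact_mod_cast Real.pi_ne_zero
  obtain ⟨z, hz⟩ := exists_theta1_ne_zero hτ
  exact ⟨z / Real.pi, mul_ne_zero (exp_ne_zero _) (by rwa [mul_div_cancel₀ _ hπ])⟩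

/-- An entire function with the quasi-periodicity of `θ₁` is a multiple of `θ₁`. -/
lemma exists_eq_const_mul_theta1 {τ : ℂ} (hτ : 0 < τ.im) {f : ℂ → ℂ} (hf : Differentiable ℂ f)
    (h1 : ∀ z, f (z + Real.pi) = -f z)
    (h2 : ∀ z, f (z + Real.pi * τ) = -cexp (-(Real.pi * I * τ) - 2 * I * z) * f z) :
    ∃ c, ∀ z, f z = c * theta1 z τ := by
  have hπ : (Real.pi : ℂ) ≠ 0 := by exact_mod_cast Real.pi_ne_zero
  obtain ⟨p1, p2⟩ := exp_mul_quasiperiodic h1 h2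
  obtain ⟨t1, t2⟩ := exp_mul_quasiperiodic (f := fun z ↦ theta1 z τ)
    (theta1_add_pi hτ) (theta1_add_pi_mul hτ)
  have hθ := differentiable_theta1 hτ
  obtain ⟨c, hc⟩ := exists_eq_const_mul_of_quasiperiodic
    (g := fun w ↦ cexp (Real.pi * I * w) * theta1 (Real.pi * w) τ)
    (h := fun w ↦ cexp (Real.pi * I * w) * f (Real.pi * w))
    (.mul (by fun_prop) (hθ.comp (by fun_prop : Differentiable ℂ fun w : ℂ ↦ Real.pi * w))) t1 t2
    (.mul (by fun_prop) (hf.comp (by fun_prop : Differentiable ℂ fun w : ℂ ↦ Real.pi * w))) p1 p2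
    (exists_exp_mul_theta1_ne_zero hτ)
  refine ⟨c, fun z ↦ ?_⟩
  have := hc (z / Real.pi)
  simp only [mul_div_cancel₀ _ hπ] at this
  refine mul_left_cancel₀ (exp_ne_zero (Real.pi * I * (z / Real.pi))) ?_
  linear_combination this

/-- The zero of `θ₁` at the origin is simple. -/
lemma deriv_theta1_zero_ne_zero {τ : ℂ} (hτ : 0 < τ.im) : deriv (fun z ↦ theta1 z τ) 0 ≠ 0 := by
  intro h0
  obtain ⟨h, hd, h1, h2, hne⟩ := exists_quasiperiodic_deriv_ne_zero hτ
  obtain ⟨t1, t2⟩ := exp_mul_quasiperiodic (f := fun z ↦ theta1 z τ)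
    (theta1_add_pi hτ) (theta1_add_pi_mul hτ)
  have hθ := differentiable_theta1 hτ
  obtain ⟨c, hc⟩ := exists_eq_const_mul_of_quasiperiodic
    (g := fun w ↦ cexp (Real.pi * I * w) * theta1 (Real.pi * w) τ)
    (.mul (by fun_prop) (hθ.comp (by fun_prop : Differentiable ℂ fun w : ℂ ↦ Real.pi * w))) t1 t2
    hd h1 h2 (exists_exp_mul_theta1_ne_zero hτ)
  have d1 : HasDerivAt (fun w ↦ theta1 (Real.pi * w) τ) 0 0 := by
    have a : HasDerivAt (fun z ↦ theta1 z τ) 0 (Real.pi * 0) := by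
      have h := (hθ 0).hasDerivAt
      rw [h0] at h
      rwa [mul_zero]
    simpa using! a.comp 0 ((hasDerivAt_id (0 : ℂ)).const_mul (Real.pi : ℂ))
  have d2 : HasDerivAt (fun w ↦ cexp (Real.pi * I * w))
      (deriv (fun w ↦ cexp (Real.pi * I * w)) 0) 0 :=
    DifferentiableAt.hasDerivAt (by fun_prop)
  have d3 := (d2.mul d1).const_mul c
  apply hne
  rw [funext hc]
  simpa [theta1_zero] using! d3.deriv

/-- Shifting the index of a product over `{-l, …, l}` by one. -/
lemma prod_Icc_neg_add_one {M : Type*} [CommMonoid M] (l : ℕ) (F : ℤ → M) (a : M)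
    (h : F (l + 1) = a * F (-l)) :
    ∏ k ∈ Finset.Icc (-(l : ℤ)) l, F (k + 1) = a * ∏ k ∈ Finset.Icc (-(l : ℤ)) l, F k := by
  have e1 : ∏ k ∈ Finset.Icc (-(l : ℤ)) l, F (k + 1) =
      ∏ k ∈ Finset.Icc (-(l : ℤ) + 1) (l + 1), F k := by
    rw [← Finset.image_add_right_Icc, Finset.prod_image (by simp)]
  have e2 : Finset.Icc (-(l : ℤ) + 1) (l + 1) =
      insert ((l : ℤ) + 1) (Finset.Icc (-(l : ℤ) + 1) l) := by
    ext; simp only [Finset.mem_Icc, Finset.mem_insert]; lia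
  have e3 : Finset.Icc (-(l : ℤ)) l = insert (-(l : ℤ)) (Finset.Icc (-(l : ℤ) + 1) l) := by
    ext; simp only [Finset.mem_Icc, Finset.mem_insert]; lia
  rw [e1, e2, e3, Finset.prod_insert (by simp), Finset.prod_insert (by simp), h, mul_assoc]

lemma sum_Icc_neg_intCast (l : ℕ) : ∑ k ∈ Finset.Icc (-(l : ℤ)) l, (k : ℂ) = 0 := by
  have h : ∑ k ∈ Finset.Icc (-(l : ℤ)) l, (k : ℂ) = ∑ k ∈ Finset.Icc (-(l : ℤ)) l, -(k : ℂ) :=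
    Finset.sum_equiv (Equiv.neg ℤ) (fun k ↦ by simp only [Finset.mem_Icc, Equiv.neg_apply]; lia)
      (fun k _ ↦ by simp)
  rw [Finset.sum_neg_distrib] at h
  exact self_eq_neg.mp h

lemma card_Icc_neg (l : ℕ) : (Finset.Icc (-(l : ℤ)) l).card = 2 * l + 1 := by
  rw [Int.card_Icc]; lia

/-- The product of the translates of `θ₁` by the `n`-division points, `n = 2l + 1`, as a function
of `w = n z`. -/
noncomputable def divisionProd (l : ℕ) (τ w : ℂ) : ℂ :=
  ∏ k ∈ Finset.Icc (-(l : ℤ)) (l : ℤ), ∏ j ∈ Finset.Icc (-(l : ℤ)) (l : ℤ),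
    theta1 (w / (2 * (l : ℂ) + 1) + (k : ℂ) * (Real.pi : ℂ) / (2 * (l : ℂ) + 1) +
      (j : ℂ) * (Real.pi : ℂ) * τ / (2 * (l : ℂ) + 1)) τ

lemma two_mul_natCast_add_one_ne_zero (l : ℕ) : 2 * (l : ℂ) + 1 ≠ 0 := by
  exact_mod_cast (2 * l).succ_ne_zero

lemma divisionProd_add_pi {τ : ℂ} (hτ : 0 < τ.im) (l : ℕ) (w : ℂ) :
    divisionProd l τ (w + Real.pi) = -divisionProd l τ w := by
  have hn := two_mul_natCast_add_one_ne_zero l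
  unfold divisionProd
  rw [Finset.prod_comm, Finset.prod_comm (s := Finset.Icc (-(l : ℤ)) l)
    (f := fun k j : ℤ ↦ theta1 (w / (2 * (l : ℂ) + 1) + (k : ℂ) * (Real.pi : ℂ) / (2 * (l : ℂ) + 1) +
      (j : ℂ) * (Real.pi : ℂ) * τ / (2 * (l : ℂ) + 1)) τ)]
  have key : ∀ j ∈ Finset.Icc (-(l : ℤ)) l, _ = _ := fun j _ ↦
    prod_Icc_neg_add_one l (fun k : ℤ ↦ theta1 (w / (2 * (l : ℂ) + 1) +
      (k : ℂ) * (Real.pi : ℂ) / (2 * (l : ℂ) + 1) +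
      (j : ℂ) * (Real.pi : ℂ) * τ / (2 * (l : ℂ) + 1)) τ) (-1) (by
        rw [neg_one_mul, ← theta1_add_pi hτ]
        congr 1
        push_cast
        field_simp
        ring)
  have h := Finset.prod_congr rfl key
  rw [Finset.prod_mul_distrib, Finset.prod_const, card_Icc_neg, Odd.neg_one_pow ⟨l, rfl⟩,
    neg_one_mul] at h
  rw [← h]
  refine Finset.prod_congr rfl fun j _ ↦ Finset.prod_congr rfl fun k _ ↦ ?_
  congr 1
  push_cast
  ring

lemma divisionProd_add_pi_mul {τ : ℂ} (hτ : 0 < τ.im) (l : ℕ) (w : ℂ) :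
    divisionProd l τ (w + Real.pi * τ) =
      -cexp (-(Real.pi * I * τ) - 2 * I * w) * divisionProd l τ w := by
  have hn := two_mul_natCast_add_one_ne_zero l
  unfold divisionProd
  have key : ∀ k ∈ Finset.Icc (-(l : ℤ)) l, _ = _ := fun k _ ↦
    prod_Icc_neg_add_one l (fun j : ℤ ↦ theta1 (w / (2 * (l : ℂ) + 1) +
      (k : ℂ) * (Real.pi : ℂ) / (2 * (l : ℂ) + 1) +
      (j : ℂ) * (Real.pi : ℂ) * τ / (2 * (l : ℂ) + 1)) τ)
      (-1 * cexp (-(Real.pi * I * τ) - 2 * I * (w / (2 * (l : ℂ) + 1) +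
        (k : ℂ) * (Real.pi : ℂ) / (2 * (l : ℂ) + 1) +
        ((-l : ℤ) : ℂ) * (Real.pi : ℂ) * τ / (2 * (l : ℂ) + 1)))) (by
        rw [neg_one_mul, ← theta1_add_pi_mul hτ]
        congr 1
        push_cast
        field_simp
        ring)
  have h := Finset.prod_congr rfl key
  have hsum : ∑ k ∈ Finset.Icc (-(l : ℤ)) l, (-(Real.pi * I * τ) - 2 * I * (w / (2 * (l : ℂ) + 1) +
        (k : ℂ) * (Real.pi : ℂ) / (2 * (l : ℂ) + 1) +
        ((-l : ℤ) : ℂ) * (Real.pi : ℂ) * τ / (2 * (l : ℂ) + 1))) =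
      -(Real.pi * I * τ) - 2 * I * w := by
    have e : ∀ k : ℤ, (-(Real.pi * I * τ) - 2 * I * (w / (2 * (l : ℂ) + 1) +
        (k : ℂ) * (Real.pi : ℂ) / (2 * (l : ℂ) + 1) +
        ((-l : ℤ) : ℂ) * (Real.pi : ℂ) * τ / (2 * (l : ℂ) + 1))) =
        (-(Real.pi * I * τ) - 2 * I * w) / (2 * (l : ℂ) + 1) +
        (k : ℂ) * (-2 * I * Real.pi / (2 * (l : ℂ) + 1)) := by
      intro k
      push_cast
      field_simp
      ring
    simp only [e]
    rw [Finset.sum_add_distrib, ← Finset.sum_mul, sum_Icc_neg_intCast, Finset.sum_const,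
      card_Icc_neg]
    simp only [nsmul_eq_mul]
    push_cast
    field_simp
    ring
  rw [Finset.prod_mul_distrib, Finset.prod_mul_distrib, Finset.prod_const, card_Icc_neg,
    Odd.neg_one_pow ⟨l, rfl⟩, ← exp_sum, hsum, neg_one_mul] at h
  rw [← h]
  refine Finset.prod_congr rfl fun k _ ↦ Finset.prod_congr rfl fun j _ ↦ ?_
  congr 1
  push_cast
  ring

lemma differentiable_divisionProd {τ : ℂ} (hτ : 0 < τ.im) (l : ℕ) :
    Differentiable ℂ (divisionProd l τ) := by
  unfold divisionProd
  refine Differentiable.fun_finsetProd fun k _ ↦ Differentiable.fun_finsetProd fun j _ ↦ ?_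
  exact (differentiable_theta1 hτ).comp (by fun_prop)

lemma eventually_theta1_ne_zero {τ : ℂ} (hτ : 0 < τ.im) {a : ℂ} (ha : a ≠ 0) (b : ℂ) :
    ∀ᶠ w in 𝓝[≠] (0 : ℂ), theta1 (w / a + b) τ ≠ 0 := by
  have hd : Differentiable ℂ fun w ↦ theta1 (w / a + b) τ :=
    (differentiable_theta1 hτ).comp (by fun_prop : Differentiable ℂ fun w : ℂ ↦ w / a + b)
  have han := hd.differentiableOn.analyticOnNhd isOpen_univ
  by_contra h
  have h0 := han.eqOn_zero_of_preconnected_of_frequently_eq_zero isPreconnected_univ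
    (Set.mem_univ 0) ((not_eventually.mp h).mono fun _ hw ↦ not_not.mp hw)
  obtain ⟨z, hz⟩ := exists_theta1_ne_zero hτ
  refine hz ?_
  have := h0 (Set.mem_univ ((z - b) * a))
  simpa [ha] using this

lemma exists_divisionProd_ne_zero {τ : ℂ} (hτ : 0 < τ.im) (l : ℕ) :
    ∃ w, divisionProd l τ w ≠ 0 := by
  have h : ∀ᶠ w in 𝓝[≠] (0 : ℂ), ∀ k ∈ Finset.Icc (-(l : ℤ)) l, ∀ j ∈ Finset.Icc (-(l : ℤ)) l,
      theta1 (w / (2 * (l : ℂ) + 1) + ((k : ℂ) * (Real.pi : ℂ) / (2 * (l : ℂ) + 1) +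
      (j : ℂ) * (Real.pi : ℂ) * τ / (2 * (l : ℂ) + 1))) τ ≠ 0 :=
    (Finset.eventually_all _).mpr fun k _ ↦ (Finset.eventually_all _).mpr fun j _ ↦
      eventually_theta1_ne_zero hτ (two_mul_natCast_add_one_ne_zero l) _
  obtain ⟨w, hw⟩ := h.exists
  refine ⟨w, Finset.prod_ne_zero_iff.mpr fun k hk ↦ Finset.prod_ne_zero_iff.mpr fun j hj ↦ ?_⟩
  rw [add_assoc]
  exact hw k hk j hj

lemma deriv_divisionProd_zero {τ : ℂ} (hτ : 0 < τ.im) (l : ℕ) :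
    deriv (divisionProd l τ) 0 = deriv (fun z ↦ theta1 z τ) 0 * (1 / (2 * (l : ℂ) + 1) *
      ∏ p ∈ (Finset.Icc (-(l : ℤ)) (l : ℤ) ×ˢ Finset.Icc (-(l : ℤ)) (l : ℤ)).erase (0, 0),
        theta1 ((p.1 : ℂ) * (Real.pi : ℂ) / (2 * (l : ℂ) + 1) +
          (p.2 : ℂ) * (Real.pi : ℂ) * τ / (2 * (l : ℂ) + 1)) τ) := by
  have hθ := differentiable_theta1 hτ
  set n : ℂ := 2 * (l : ℂ) + 1 with hn
  set s := (Finset.Icc (-(l : ℤ)) (l : ℤ) ×ˢ Finset.Icc (-(l : ℤ)) (l : ℤ)) with hs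
  set R : ℂ → ℂ := fun w ↦ ∏ p ∈ s.erase (0, 0), theta1 (w / n + (p.1 : ℂ) * (Real.pi : ℂ) / n +
    (p.2 : ℂ) * (Real.pi : ℂ) * τ / n) τ with hR
  have hRd : Differentiable ℂ R :=
    Differentiable.fun_finsetProd fun p _ ↦ hθ.comp (by fun_prop)
  have hmul : divisionProd l τ = (fun w ↦ theta1 (w / n) τ) * R := by
    funext w
    rw [divisionProd, ← Finset.prod_product', ← hs,
      ← Finset.mul_prod_erase s _ (a := (0, 0)) (by simp [hs])]
    simp [hR, hn]
  have h1 : HasDerivAt (fun w ↦ theta1 (w / n) τ) (deriv (fun z ↦ theta1 z τ) 0 * (1 / n)) 0 := by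
    have a : HasDerivAt (fun z ↦ theta1 z τ) (deriv (fun z ↦ theta1 z τ) 0) (0 / n) := by
      rw [zero_div]; exact (hθ 0).hasDerivAt
    exact HasDerivAt.comp (h₂ := fun z ↦ theta1 z τ) (h := fun w ↦ w / n) 0 a
      ((hasDerivAt_id (0 : ℂ)).div_const n)
  rw [hmul, (h1.mul (hRd 0).hasDerivAt).deriv]
  simp [theta1_zero, hR, mul_assoc]

/-- Theorem 3, odd case: (2l+1)-tuple rule for θ₁(·|τ). -/
theorem theta1_odd_ntuple (τ : ℂ) (hτ : 0 < τ.im) (l : ℕ) (hl : 1 ≤ l) (z : ℂ) :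
    theta1 ((2 * (l : ℂ) + 1) * z) τ =
      (1 / (2 * (l : ℂ) + 1) *
          ∏ p ∈ (Finset.Icc (-(l : ℤ)) (l : ℤ) ×ˢ Finset.Icc (-(l : ℤ)) (l : ℤ)).erase (0, 0),
            theta1 ((p.1 : ℂ) * (Real.pi : ℂ) / (2 * (l : ℂ) + 1) +
              (p.2 : ℂ) * (Real.pi : ℂ) * τ / (2 * (l : ℂ) + 1)) τ)⁻¹ *
        ∏ k ∈ Finset.Icc (-(l : ℤ)) (l : ℤ), ∏ j ∈ Finset.Icc (-(l : ℤ)) (l : ℤ),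
          theta1 (z + (k : ℂ) * (Real.pi : ℂ) / (2 * (l : ℂ) + 1) +
            (j : ℂ) * (Real.pi : ℂ) * τ / (2 * (l : ℂ) + 1)) τ := by
  obtain ⟨c, hc⟩ := exists_eq_const_mul_theta1 hτ (differentiable_divisionProd hτ l)
    (divisionProd_add_pi hτ l) (divisionProd_add_pi_mul hτ l)
  have hc0 : c ≠ 0 := by
    rintro rfl
    obtain ⟨w, hw⟩ := exists_divisionProd_ne_zero hτ l
    exact hw (by rw [hc, zero_mul])
  have hder := deriv_divisionProd_zero hτ l
  rw [funext hc, deriv_const_mul _ (differentiable_theta1 hτ 0), mul_comm c] at hder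
  rw [← mul_left_cancel₀ (deriv_theta1_zero_ne_zero hτ) hder]
  have h := hc ((2 * (l : ℂ) + 1) * z)
  rw [divisionProd, mul_div_cancel_left₀ _ (two_mul_natCast_add_one_ne_zero l)] at h
  rw [h, inv_mul_cancel_left₀ hc0]
end
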